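/- For every natural number j and every N ∈ ℕ there exist ε, M > 0 such that for all t ∈ (0,ε), | t^{j + 1/2} · Σ_{m ∈ ℤ} m^{2j} e^{−t m²} − Γ(j + 1/2) | ≤ M t^{N}. In particular, for j = 0: √t · Σ_{m∈ℤ} e^{−t m²} − √π = O(t^N) as t → 0+ for every N, and for each j the function t ↦ t^{j+1/2} Σ_{m∈ℤ} m^{2j} e^{−tm²} has an asymptotic power series expansion near 0 whose constant term is Γ(j+1/2) and whose higher coefficients all vanish. -/

import Mathlib

open Topology Filter Set

open scoped SchwartzMap FourierTransform Polynomial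

open MeasureTheory

lemma exists_forall_norm_eval_mul_exp_neg_sq_le (P : ℝ[X]) :
    ∃ C, ∀ x : ℝ, ‖P.eval x * Real.exp (-x ^ 2)‖ ≤ C := by
  induction P using Polynomial.induction_on' with
  | add p q hp hq =>
    obtain ⟨C, hC⟩ := hp
    obtain ⟨D, hD⟩ := hq
    refine ⟨C + D, fun x => ?_⟩
    rw [Polynomial.eval_add, add_mul]
    exact (norm_add_le _ _).trans (add_le_add (hC x) (hD x))
  | monomial n a =>
    refine ⟨|a| * (1 + n.factorial), fun x => ?_⟩
    have h₁ : |x| ^ n ≤ 1 + (x ^ 2) ^ n := by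
      rw [← sq_abs x, ← pow_mul, mul_comm 2 n, pow_mul]
      nlinarith [sq_nonneg (|x| ^ n - 1), sq_nonneg (|x| ^ n)]
    have h₂ : (x ^ 2) ^ n ≤ n.factorial * Real.exp (x ^ 2) := by
      have := Real.pow_div_factorial_le_exp (x ^ 2) (sq_nonneg x) n
      rwa [div_le_iff₀' (by positivity)] at this
    have h₃ : 1 ≤ Real.exp (x ^ 2) := Real.one_le_exp (sq_nonneg x)
    rw [Polynomial.eval_monomial, mul_assoc, norm_mul, norm_mul, Real.norm_eq_abs, norm_pow,
      Real.norm_eq_abs, Real.norm_eq_abs, Real.abs_exp, Real.exp_neg, ← div_eq_mul_inv]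
    gcongr
    rw [div_le_iff₀ (Real.exp_pos _)]
    linarith

lemma hasDerivAt_eval_mul_exp_neg_sq (P : ℝ[X]) (x : ℝ) :
    HasDerivAt (fun y : ℝ => P.eval y * Real.exp (-y ^ 2))
      ((Polynomial.derivative P - Polynomial.C 2 * Polynomial.X * P).eval x
        * Real.exp (-x ^ 2)) x := by
  convert! (P.hasDerivAt x).mul ((hasDerivAt_pow 2 x).neg.exp) using 1
  simp
  ring

lemma exists_iteratedDeriv_eval_mul_exp_neg_sq (n : ℕ) (P : ℝ[X]) :
    ∃ Q : ℝ[X], iteratedDeriv n (fun x : ℝ => P.eval x * Real.exp (-x ^ 2)) =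
      fun x => Q.eval x * Real.exp (-x ^ 2) := by
  induction n generalizing P with
  | zero => exact ⟨P, iteratedDeriv_zero⟩
  | succ n ih =>
    rw [iteratedDeriv_succ', funext fun x => (hasDerivAt_eval_mul_exp_neg_sq P x).deriv]
    exact ih _

/-- The product of a polynomial and the Gaussian `e^{-x²}`, as a Schwartz function. -/
noncomputable def polynomialMulGaussian (P : ℝ[X]) : 𝓢(ℝ, ℝ) where
  toFun x := P.eval x * Real.exp (-x ^ 2)
  smooth' := by
    have h : ContDiff ℝ (⊤ : ℕ∞) fun x : ℝ => P.eval x := by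
      simpa using P.contDiff_aeval (𝕜 := ℝ) (⊤ : ℕ∞)
    fun_prop
  decay' k n := by
    obtain ⟨Q, hQ⟩ := exists_iteratedDeriv_eval_mul_exp_neg_sq n P
    obtain ⟨C, hC⟩ := exists_forall_norm_eval_mul_exp_neg_sq_le (Polynomial.X ^ k * Q)
    refine ⟨C, fun x => ?_⟩
    rw [norm_iteratedFDeriv_eq_norm_iteratedDeriv, hQ, ← norm_pow, ← norm_mul, ← mul_assoc]
    simpa using hC x

lemma integral_pow_mul_exp_neg_sq (j : ℕ) :
    ∫ x : ℝ, x ^ (2 * j) * Real.exp (-x ^ 2) = Real.Gamma ((j : ℝ) + 1 / 2) := by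
  have h := integral_comp_abs (f := fun x : ℝ => x ^ (2 * j) * Real.exp (-x ^ 2))
  simp only [pow_mul, sq_abs] at h
  have h' := integral_rpow_mul_exp_neg_rpow (p := 2) (q := (2 * j : ℕ)) two_pos
    (by linarith [(2 * j).cast_nonneg (α := ℝ)])
  simp only [Real.rpow_natCast, Real.rpow_two, pow_mul] at h'
  simp only [pow_mul]
  rw [h, h']
  push_cast
  rw [← mul_assoc]
  norm_num
  congr 1
  ring

lemma fourier_comp_mul_left (f : ℝ → ℂ) {s : ℝ} (hs : 0 < s) (w : ℝ) :
    𝓕 (fun x => f (s * x)) w = (s⁻¹ : ℝ) • 𝓕 f (w / s) := by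
  rw [Real.fourier_real_eq, Real.fourier_real_eq]
  have h := Measure.integral_comp_mul_left (fun v => Real.fourierChar (-(v * (w / s))) • f v) s
  rw [abs_of_pos (inv_pos.2 hs)] at h
  rw [← h]
  congr 1 with x
  congr 3
  field_simp

lemma SchwartzMap.mul_tsum_comp_mul_eq_tsum_fourier (f : 𝓢(ℝ, ℂ)) {s : ℝ} (hs : 0 < s) :
    (s : ℂ) * ∑' n : ℤ, f (s * n) = ∑' n : ℤ, 𝓕 f ((n : ℝ) / s) := by
  let e : ℝ ≃L[ℝ] ℝ := ContinuousLinearEquiv.unitsEquivAut ℝ (Units.mk0 s hs.ne')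
  let g := compCLMOfContinuousLinearEquiv ℂ e f
  have hg : ∀ x, g x = f (s * x) := fun x => by simp [g, e, mul_comm]
  have h := g.tsum_eq_tsum_fourier 0
  have hF : ∀ w, 𝓕 g w = (s⁻¹ : ℝ) • 𝓕 f (w / s) := fun w => by
    rw [fourier_coe, fourier_coe, funext hg, fourier_comp_mul_left _ hs]
  simp only [zero_add, hg, hF] at h
  rw [h]
  simp only [QuotientAddGroup.mk_zero, fourier_eval_zero, mul_one, Complex.real_smul]
  rw [tsum_mul_left, ← mul_assoc, ← Complex.ofReal_mul, mul_inv_cancel₀ hs.ne']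
  simp

/-- Riemann sums of a Schwartz function over `sℤ` converge to the integral faster than any power
of the mesh `s`. -/
lemma SchwartzMap.exists_norm_mul_tsum_sub_integral_le (f : 𝓢(ℝ, ℂ)) {k : ℕ} (hk : 1 < k) :
    ∃ M > (0 : ℝ), ∀ s > (0 : ℝ), ‖(s : ℂ) * ∑' n : ℤ, f (s * n) - ∫ x, f x‖ ≤ M * s ^ k := by
  obtain ⟨C, hC₀, hC⟩ := (𝓕 f).decay k 0
  have hsum : Summable fun n : ℤ => 1 / |(n : ℝ) ^ k| := by
    simpa using (Real.summable_one_div_int_pow.2 hk).abs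
  have hpos : 0 < ∑' n : ℤ, 1 / |(n : ℝ) ^ k| :=
    hsum.tsum_pos (fun n => by positivity) 1 (by simp)
  refine ⟨C * ∑' n : ℤ, 1 / |(n : ℝ) ^ k|, by positivity, fun s hs => ?_⟩
  have hb : ∀ n : ℤ, n ≠ 0 → ‖𝓕 f ((n : ℝ) / s)‖ ≤ C * s ^ k * (1 / |(n : ℝ) ^ k|) := fun n hn => by
    have hn' : (0 : ℝ) < |(n : ℝ)| := by positivity
    have h := hC ((n : ℝ) / s)
    rw [norm_iteratedFDeriv_zero, norm_div, Real.norm_eq_abs, Real.norm_of_nonneg hs.le,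
      div_pow] at h
    rw [abs_pow, mul_one_div, le_div_iff₀ (by positivity)]
    rw [div_mul_eq_mul_div, div_le_iff₀ (by positivity)] at h
    linarith
  have hsummable : Summable fun n : ℤ => 𝓕 f ((n : ℝ) / s) := by
    refine Summable.of_norm_bounded_eventually (hsum.mul_left (C * s ^ k)) ?_
    filter_upwards [(Set.finite_singleton (0 : ℤ)).compl_mem_cofinite] with n hn using hb n hn
  have h0 : 𝓕 f (((0 : ℤ) : ℝ) / s) = ∫ x, f x := by
    simp [fourier_coe, Real.fourier_real_eq]
  rw [f.mul_tsum_comp_mul_eq_tsum_fourier hs, hsummable.tsum_eq_add_tsum_ite 0, h0,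
    add_sub_cancel_left, mul_right_comm]
  refine tsum_of_norm_bounded (hsum.hasSum.mul_left (C * s ^ k)) fun n => ?_
  split_ifs with hn
  · rw [norm_zero]
    positivity
  · exact hb n hn

/-- Heat kernel expansion for the theta-like sums of the noncommutative torus: for every
`j` and `N`, `t^{j+1/2} ∑_{m ∈ ℤ} m^{2j} e^{-t m²} = Γ(j + 1/2) + O(t^N)` as `t → 0+`. -/
theorem theta_sum_asymptotic :
    ∀ j N : ℕ, ∃ ε > (0 : ℝ), ∃ M > (0 : ℝ), ∀ t ∈ Set.Ioo (0 : ℝ) ε,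
      |t ^ ((j : ℝ) + 1 / 2) * (∑' m : ℤ, (m : ℝ) ^ (2 * j) * Real.exp (-t * (m : ℝ) ^ 2))
        - Real.Gamma ((j : ℝ) + 1 / 2)| ≤ M * t ^ N := by
  intro j N
  let f : 𝓢(ℝ, ℂ) := SchwartzMap.postcompCLM Complex.ofRealCLM
    (polynomialMulGaussian (Polynomial.X ^ (2 * j)))
  have hf : ∀ x, f x = ((x ^ (2 * j) * Real.exp (-x ^ 2) : ℝ) : ℂ) := fun x => by
    change ((Polynomial.eval x (Polynomial.X ^ (2 * j)) * Real.exp (-x ^ 2) : ℝ) : ℂ) = _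
    simp
  obtain ⟨M, hM, h⟩ := f.exists_norm_mul_tsum_sub_integral_le (k := 2 * (N + 1)) (by lia)
  refine ⟨1, one_pos, M, hM, fun t ⟨ht, ht'⟩ => ?_⟩
  have hs := h (√t) (Real.sqrt_pos.2 ht)
  simp only [hf] at hs
  rw [integral_complex_ofReal, integral_pow_mul_exp_neg_sq, ← Complex.ofReal_tsum,
    ← Complex.ofReal_mul, ← Complex.ofReal_sub, Complex.norm_real, Real.norm_eq_abs,
    pow_mul, Real.sq_sqrt ht.le] at hs
  have hterm : ∀ m : ℤ, (√t * m) ^ (2 * j) * Real.exp (-(√t * m) ^ 2) =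
      t ^ j * ((m : ℝ) ^ (2 * j) * Real.exp (-t * (m : ℝ) ^ 2)) := fun m => by
    rw [mul_pow, mul_pow, pow_mul √t, Real.sq_sqrt ht.le, neg_mul, mul_assoc]
  simp only [hterm] at hs
  rw [tsum_mul_left, ← mul_assoc] at hs
  rw [Real.rpow_add ht, Real.rpow_natCast, ← Real.sqrt_eq_rpow, mul_comm (t ^ j)]
  refine hs.trans ?_
  gcongr M * ?_
  exact pow_le_pow_of_le_one ht.le ht'.le N.le_succ
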